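/- Additive linear logic with contraction (ALL C) is safe for the majority rule: for every agenda Φ of ALL formulas, every odd number n ≥ 3 of agents, and every profile (J_1,…,J_n) of judgment sets over Φ that are complete and robustly consistent in ALL C, the majority outcome M(J) is robustly consistent in ALL C. In particular, every derivable sequent of ALL C contains at most two formula occurrences, so every minimally ALL C-inconsistent multiset has cardinality at most 2. -/

import Mathlib

namespace Stmt15

/-- Formulas of additive linear logic (ALL): atoms, linear negation, & and ⊕, no units. -/
inductive AForm : Type
  | atom  : ℕ → AForm
  | neg   : AForm → AForm
  | awith : AForm → AForm → AForm         -- &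
  | aplus : AForm → AForm → AForm         -- ⊕
  deriving DecidableEq

/-- Sequent calculus for ALL C: the ALL rules plus left and right contraction. -/
inductive ACDeriv : Multiset AForm → Multiset AForm → Prop
  | ax (A) : ACDeriv {A} {A}
  | cut {Γ Δ Γ' Δ' A} : ACDeriv (A ::ₘ Γ) Δ → ACDeriv Γ' (A ::ₘ Δ') →
      ACDeriv (Γ + Γ') (Δ + Δ')
  | negL {Γ Δ A} : ACDeriv Γ (A ::ₘ Δ) → ACDeriv (AForm.neg A ::ₘ Γ) Δ
  | negR {Γ Δ A} : ACDeriv (A ::ₘ Γ) Δ → ACDeriv Γ (AForm.neg A ::ₘ Δ)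
  | withR {Γ Δ A B} : ACDeriv Γ (A ::ₘ Δ) → ACDeriv Γ (B ::ₘ Δ) →
      ACDeriv Γ (AForm.awith A B ::ₘ Δ)
  | withL1 {Γ Δ A B} : ACDeriv (A ::ₘ Γ) Δ → ACDeriv (AForm.awith A B ::ₘ Γ) Δ
  | withL2 {Γ Δ A B} : ACDeriv (B ::ₘ Γ) Δ → ACDeriv (AForm.awith A B ::ₘ Γ) Δ
  | plusL {Γ Δ A B} : ACDeriv (A ::ₘ Γ) Δ → ACDeriv (B ::ₘ Γ) Δ →
      ACDeriv (AForm.aplus A B ::ₘ Γ) Δ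
  | plusR1 {Γ Δ A B} : ACDeriv Γ (A ::ₘ Δ) → ACDeriv Γ (AForm.aplus A B ::ₘ Δ)
  | plusR2 {Γ Δ A B} : ACDeriv Γ (B ::ₘ Δ) → ACDeriv Γ (AForm.aplus A B ::ₘ Δ)
  | contrL {Γ Δ A} : ACDeriv (A ::ₘ A ::ₘ Γ) Δ → ACDeriv (A ::ₘ Γ) Δ
  | contrR {Γ Δ A} : ACDeriv Γ (A ::ₘ A ::ₘ Δ) → ACDeriv Γ (A ::ₘ Δ)

/-- ALL C-inconsistency. -/
def ACInconsistent (Γ : Multiset AForm) : Prop := ACDeriv Γ 0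

/-- Robust consistency in ALL C. -/
def robustlyConsistentC (Γ : Multiset AForm) : Prop :=
  ∀ Δ : Multiset AForm, Δ ≤ Γ → ¬ ACInconsistent Δ

def AForm.compl : AForm → AForm
  | .neg ψ => ψ
  | φ      => .neg φ

def completeOn (Φ J : Finset AForm) : Prop := ∀ φ ∈ Φ, φ ∈ J ∨ φ.compl ∈ J

def isAgenda (Φ : Finset AForm) : Prop :=
  (∀ φ ∈ Φ, φ.compl ∈ Φ) ∧ ∀ φ ∈ Φ, ¬ ACDeriv 0 {φ} ∧ ¬ ACDeriv {φ} 0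

def nsupp (n : ℕ) (J : Fin n → Finset AForm) (φ : AForm) : ℕ :=
  (Finset.univ.filter (fun i => φ ∈ J i)).card

def maj (n : ℕ) (Φ : Finset AForm) (J : Fin n → Finset AForm) : Finset AForm :=
  Φ.filter (fun φ => n < 2 * nsupp n J φ)

theorem card_le_two {Γ Δ : Multiset AForm} (h : ACDeriv Γ Δ) :
    Multiset.card Γ + Multiset.card Δ ≤ 2 := by
  induction h <;> simp only [Multiset.card_cons, Multiset.card_add, Multiset.card_singleton] at * <;>
    omega

theorem common_judge {n : ℕ} {Φ : Finset AForm} {J : Fin n → Finset AForm} {a b : AForm}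
    (ha : a ∈ maj n Φ J) (hb : b ∈ maj n Φ J) : ∃ i, a ∈ J i ∧ b ∈ J i := by
  have ha := (Finset.mem_filter.1 ha).2
  have hb := (Finset.mem_filter.1 hb).2
  unfold nsupp at ha hb
  by_contra hne
  push Not at hne
  have hd : Disjoint (Finset.univ.filter (fun i => a ∈ J i))
      (Finset.univ.filter (fun i => b ∈ J i)) := by
    rw [Finset.disjoint_filter]
    intro i _ h
    exact hne i h
  have h1 := Finset.card_union_of_disjoint hd
  have h2 := Finset.card_le_univ (Finset.univ.filter (fun i => a ∈ J i) ∪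
    Finset.univ.filter (fun i => b ∈ J i))
  rw [Fintype.card_fin] at h2
  omega

/-- ALL with contraction is safe for the majority rule: for every agenda
of ALL formulas, every odd n ≥ 3, and every profile of complete judgment sets robustly
consistent in ALL C, the majority outcome is robustly consistent in ALL C.  In
particular, every derivable sequent of ALL C has at most two formula occurrences, so
every minimally ALL C-inconsistent multiset has cardinality at most 2. -/
theorem allC_safe_for_majority :
    (∀ (Φ : Finset AForm), isAgenda Φ →
      ∀ (n : ℕ), Odd n → 3 ≤ n →
        ∀ J : Fin n → Finset AForm,
          (∀ i, J i ⊆ Φ ∧ completeOn Φ (J i) ∧ robustlyConsistentC (J i).val) →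
          robustlyConsistentC (maj n Φ J).val) ∧
    (∀ Γ Δ : Multiset AForm, ACDeriv Γ Δ → Multiset.card Γ + Multiset.card Δ ≤ 2) ∧
    (∀ Γ : Multiset AForm, ACInconsistent Γ → (∀ Δ < Γ, ¬ ACInconsistent Δ) →
      Multiset.card Γ ≤ 2) := by
  refine ⟨?_, fun _ _ h => card_le_two h, fun Γ h _ => by simpa using card_le_two h⟩
  intro Φ _ n _ hn J hJ Δ hΔ hinc
  have hc : Multiset.card Δ ≤ 2 := by simpa using card_le_two hinc
  have hnd : Δ.Nodup := Multiset.nodup_of_le hΔ (maj n Φ J).nodup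
  have hsub : ∀ x ∈ Δ, x ∈ maj n Φ J := fun x hx => Multiset.mem_of_le hΔ hx
  suffices h : ∃ i, ∀ x ∈ Δ, x ∈ J i by
    obtain ⟨i, hi⟩ := h
    exact (hJ i).2.2 Δ ((Multiset.le_iff_subset hnd).2 hi) hinc
  have hcases : Multiset.card Δ = 0 ∨ Multiset.card Δ = 1 ∨ Multiset.card Δ = 2 := by omega
  rcases hcases with h | h | h
  · rw [Multiset.card_eq_zero] at h
    subst h
    exact ⟨⟨0, by omega⟩, by simp⟩
  · obtain ⟨a, rfl⟩ := Multiset.card_eq_one.1 h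
    obtain ⟨i, hi, _⟩ := common_judge (hsub a (by simp)) (hsub a (by simp))
    exact ⟨i, by simpa using hi⟩
  · obtain ⟨a, b, rfl⟩ := Multiset.card_eq_two.1 h
    obtain ⟨i, hi⟩ := common_judge (hsub a (by simp)) (hsub b (by simp))
    exact ⟨i, by simpa using hi⟩

end Stmt15
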